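/- (Proposition 1: value gap of a common world model.) Let O and A be finite nonempty sets, H a positive integer, ρ0 an initial pmf on O, r : O×A → ℝ a reward with |r| ≤ R_max, T* the true transition model and T a learned transition model, with T*(·|τ_h) absolutely continuous with respect to T(·|τ_h) for every history τ_h. Let Π be a probability distribution over finitely many behavior policies μ, let d^μ denote the trajectory pmf induced by (μ, T*), let d^Π(τ) = E_{μ∼Π}[d^μ(τ)], and let π be any target policy with induced true-dynamics trajectory pmf d^π (under T*) and model trajectory pmf d^π_T (under T). Define the KL training loss l_KL(T;Π) = E_{μ∼Π} E_{τ∼d^μ} [ (1/H) Σ_{h=0}^{H−1} KL( T*(·|τ_h) ‖ T(·|τ_h) ) ], where τ_h is the length-h prefix of τ. Let D be a metric on the trajectory space (O×A)^H and assume the averaged per-trajectory model error e_T(τ) = (1/H) Σ_{h=0}^{H−1} D_TV( T*(·|τ_h), T(·|τ_h) ) is L-Lipschitz with respect to D. Then |V^π_T − V^π_{T*}| ≤ 2 · R_max · H² · ( sqrt( 2 · l_KL(T;Π) ) + L · W_1(d^π, d^Π) ), where W_1(d^π, d^Π) is the infimum over all couplings γ of d^π and d^Π of E_{(τ,τ′)∼γ}[D(τ,τ′)].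 -/

import Mathlib

open scoped BigOperators

/-- A probability mass function on a finite type. -/
def IsPMF {Y : Type} [Fintype Y] (p : Y → ℝ) : Prop :=
  (∀ y, 0 ≤ p y) ∧ ∑ y, p y = 1

/-- Total variation distance between pmfs: `(1/2) Σ |p - q|`. -/
noncomputable def tvDist {Y : Type} [Fintype Y] (p q : Y → ℝ) : ℝ :=
  (1 / 2) * ∑ y, |p y - q y|

/-- Kullback–Leibler divergence `KL(p ‖ q) = Σ_y p(y) log(p(y)/q(y))`
(with the convention `0 · log(0/q) = 0`, which holds automatically here). -/
noncomputable def klDiv {Y : Type} [Fintype Y] (p q : Y → ℝ) : ℝ :=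
  ∑ y, p y * Real.log (p y / q y)

/-- A transition model: a pmf on observations for every history. -/
abbrev TransModel (O A : Type) := ∀ h : ℕ, (Fin h → O × A) → O → ℝ

/-- A policy: a pmf on actions given a history together with the current observation. -/
abbrev Policy (O A : Type) := ∀ h : ℕ, (Fin h → O × A) → O → A → ℝ

/-- The length-`h` prefix of a trajectory. -/
def prefTraj {O A : Type} {H : ℕ} (τ : Fin H → O × A) (h : Fin H) :
    Fin h.val → O × A :=
  fun i => τ ⟨i.val, i.isLt.trans h.isLt⟩

/-- The trajectory pmf on `(O × A)^H` induced by initial distribution `ρ0`,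
transition model `T` and policy `π`. -/
noncomputable def trajPMF {O A : Type} (H : ℕ) (ρ0 : O → ℝ)
    (T : TransModel O A) (π : Policy O A) : (Fin H → O × A) → ℝ :=
  fun τ => ∏ h : Fin H,
    (if h.val = 0 then ρ0 (τ h).1 else T h.val (prefTraj τ h) (τ h).1) *
      π h.val (prefTraj τ h) (τ h).1 (τ h).2

/-- The value `V^π_T = E_{τ ∼ d^π_T}[Σ_t r(o_t, a_t)]`. -/
noncomputable def value {O A : Type} [Fintype O] [Fintype A] (H : ℕ) (ρ0 : O → ℝ)
    (T : TransModel O A) (π : Policy O A) (r : O → A → ℝ) : ℝ :=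
  ∑ τ : Fin H → O × A, trajPMF H ρ0 T π τ * ∑ t : Fin H, r (τ t).1 (τ t).2

/-- The averaged per-trajectory model error
`e_T(τ) = (1/H) Σ_{h=0}^{H−1} D_TV(T*(·|τ_h), T(·|τ_h))`. -/
noncomputable def modelErr {O A : Type} [Fintype O] (H : ℕ)
    (Tstar T : TransModel O A) (τ : Fin H → O × A) : ℝ :=
  (1 / H : ℝ) * ∑ h : Fin H, tvDist (Tstar h.val (prefTraj τ h)) (T h.val (prefTraj τ h))

/-- The averaged per-trajectory KL error
`(1/H) Σ_{h=0}^{H−1} KL(T*(·|τ_h) ‖ T(·|τ_h))`. -/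
noncomputable def trajKL {O A : Type} [Fintype O] (H : ℕ)
    (Tstar T : TransModel O A) (τ : Fin H → O × A) : ℝ :=
  (1 / H : ℝ) * ∑ h : Fin H, klDiv (Tstar h.val (prefTraj τ h)) (T h.val (prefTraj τ h))

/-- Wasserstein-1 distance between pmfs on a finite space: the infimum over couplings `γ`
of `p` and `q` of the expected distance `E_γ[D]`. -/
noncomputable def W1 {S : Type} [Fintype S] (D : S → S → ℝ) (p q : S → ℝ) : ℝ :=
  sInf {c : ℝ | ∃ γ : S × S → ℝ, IsPMF γ ∧
    (∀ τ, ∑ τ', γ (τ, τ') = p τ) ∧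
    (∀ τ', ∑ τ, γ (τ, τ') = q τ') ∧
    c = ∑ pr : S × S, γ pr * D pr.1 pr.2}

/-- The probability of drawing `τ` when the next coordinate is drawn from `K` given the past. -/
noncomputable def seqPMF {X : Type} (K : ∀ h : ℕ, (Fin h → X) → X → ℝ) (n : ℕ)
    (τ : Fin n → X) : ℝ :=
  ∏ h : Fin n, K h.val (fun i => τ ⟨i.val, i.isLt.trans h.isLt⟩) (τ h)

theorem sum_snoc {X : Type} [Fintype X] (n : ℕ) (f : (Fin (n + 1) → X) → ℝ) :
    ∑ τ, f τ = ∑ τ : Fin n → X, ∑ x, f (Fin.snoc τ x) := by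
  rw [← (Fin.snocEquiv (fun _ : Fin (n + 1) => X)).sum_comp, Fintype.sum_prod_type,
    Finset.sum_comm]
  rfl

theorem snoc_truncate_castSucc {X : Type} {n : ℕ} (τ : Fin n → X) (x : X) (h : Fin n) :
    (fun i : Fin h.val => (Fin.snoc τ x : Fin (n + 1) → X)
      ⟨i.val, i.isLt.trans (h.isLt.trans n.lt_succ_self)⟩) =
    fun i : Fin h.val => τ ⟨i.val, i.isLt.trans h.isLt⟩ := by
  funext i
  exact Fin.snoc_castSucc (α := fun _ => X) x τ ⟨i.val, i.isLt.trans h.isLt⟩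

theorem snoc_truncate_last {X : Type} {n : ℕ} (τ : Fin n → X) (x : X) :
    (fun i : Fin n => (Fin.snoc τ x : Fin (n + 1) → X) ⟨i.val, i.isLt.trans n.lt_succ_self⟩) =
    τ := by
  funext i
  exact Fin.snoc_castSucc (α := fun _ => X) x τ i

theorem seqPMF_snoc {X : Type} (K : ∀ h : ℕ, (Fin h → X) → X → ℝ) (n : ℕ)
    (τ : Fin n → X) (x : X) :
    seqPMF K (n + 1) (Fin.snoc τ x) = seqPMF K n τ * K n τ x := by
  unfold seqPMF
  rw [Fin.prod_univ_castSucc]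
  congr 1
  · refine Finset.prod_congr rfl fun h _ => ?_
    rw [Fin.snoc_castSucc]
    exact congrArg (fun q => K h.val q (τ h)) (snoc_truncate_castSucc τ x h)
  · rw [Fin.snoc_last]
    exact congrArg (fun q => K n q x) (snoc_truncate_last τ x)

theorem isPMF_seqPMF {X : Type} [Fintype X] (K : ∀ h : ℕ, (Fin h → X) → X → ℝ) (n : ℕ)
    (hK : ∀ h, h < n → ∀ q, IsPMF (K h q)) : IsPMF (seqPMF K n) := by
  refine ⟨fun τ => Finset.prod_nonneg fun h _ => (hK h.val h.isLt _).1 _, ?_⟩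
  induction n with
  | zero => simp [seqPMF]
  | succ n ih =>
    rw [sum_snoc, ← ih fun h hh => hK h (hh.trans n.lt_succ_self)]
    refine Finset.sum_congr rfl fun τ _ => ?_
    simp_rw [seqPMF_snoc, ← Finset.mul_sum]
    rw [(hK n n.lt_succ_self τ).2, mul_one]

/-- The `ℓ¹` distance between two sequential laws is at most the expected sum of the `ℓ¹`
distances between their conditionals. -/
theorem sum_abs_seqPMF_sub_le {X : Type} [Fintype X] (K K' : ∀ h : ℕ, (Fin h → X) → X → ℝ)
    (n : ℕ) (hK : ∀ h, h < n → ∀ q, IsPMF (K h q)) (hK' : ∀ h, h < n → ∀ q, IsPMF (K' h q)) :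
    ∑ τ, |seqPMF K' n τ - seqPMF K n τ| ≤
      ∑ τ, seqPMF K n τ * ∑ h : Fin n,
        ∑ x, |K' h.val (fun i => τ ⟨i.val, i.isLt.trans h.isLt⟩) x -
          K h.val (fun i => τ ⟨i.val, i.isLt.trans h.isLt⟩) x| := by
  induction n with
  | zero => simp [seqPMF]
  | succ n ih =>
    have hn := n.lt_succ_self
    have hseq := isPMF_seqPMF K n fun h hh => hK h (hh.trans hn)
    have ih' := ih (fun h hh => hK h (hh.trans hn)) (fun h hh => hK' h (hh.trans hn))
    rw [sum_snoc, sum_snoc]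
    have hleft : ∀ τ : Fin n → X,
        ∑ x, |seqPMF K' (n + 1) (Fin.snoc τ x) - seqPMF K (n + 1) (Fin.snoc τ x)| ≤
          |seqPMF K' n τ - seqPMF K n τ| + seqPMF K n τ * ∑ x, |K' n τ x - K n τ x| := by
      intro τ
      have hx : ∀ x,
          |seqPMF K' (n + 1) (Fin.snoc τ x) - seqPMF K (n + 1) (Fin.snoc τ x)| ≤
          |seqPMF K' n τ - seqPMF K n τ| * K' n τ x + seqPMF K n τ * |K' n τ x - K n τ x| := by
        intro x
        rw [seqPMF_snoc, seqPMF_snoc]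
        calc |seqPMF K' n τ * K' n τ x - seqPMF K n τ * K n τ x|
            = |(seqPMF K' n τ - seqPMF K n τ) * K' n τ x +
                seqPMF K n τ * (K' n τ x - K n τ x)| := by ring_nf
          _ ≤ _ := (abs_add_le _ _).trans_eq (by
                rw [abs_mul, abs_mul, abs_of_nonneg ((hK' n hn τ).1 x),
                  abs_of_nonneg (hseq.1 τ)])
      refine (Finset.sum_le_sum fun x _ => hx x).trans_eq ?_
      rw [Finset.sum_add_distrib, ← Finset.mul_sum, ← Finset.mul_sum, (hK' n hn τ).2, mul_one]
    refine (Finset.sum_le_sum fun τ _ => hleft τ).trans ?_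
    rw [Finset.sum_add_distrib]
    refine (add_le_add_left ih' _).trans_eq ?_
    rw [← Finset.sum_add_distrib]
    refine Finset.sum_congr rfl fun τ _ => ?_
    have hδ : ∀ x : X, (∑ h : Fin (n + 1),
        ∑ y, |K' h.val (fun i => (Fin.snoc τ x : Fin (n + 1) → X)
            ⟨i.val, i.isLt.trans h.isLt⟩) y -
          K h.val (fun i => (Fin.snoc τ x : Fin (n + 1) → X) ⟨i.val, i.isLt.trans h.isLt⟩) y|) =
        (∑ h : Fin n, ∑ y, |K' h.val (fun i => τ ⟨i.val, i.isLt.trans h.isLt⟩) y -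
          K h.val (fun i => τ ⟨i.val, i.isLt.trans h.isLt⟩) y|) +
          ∑ y, |K' n τ y - K n τ y| := by
      intro x
      rw [Fin.sum_univ_castSucc]
      congr 1
      · exact Finset.sum_congr rfl fun h _ => congrArg
          (fun q => ∑ y, |K' h.val q y - K h.val q y|) (snoc_truncate_castSucc τ x h)
      · exact congrArg (fun q => ∑ y, |K' n q y - K n q y|) (snoc_truncate_last τ x)
    simp_rw [hδ, seqPMF_snoc]
    rw [← Finset.sum_mul, ← Finset.mul_sum, (hK n hn τ).2]
    ring

/-- The law of the next observation-action pair. -/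
noncomputable def stepPMF {O A : Type} (ρ0 : O → ℝ) (T : TransModel O A) (π : Policy O A)
    (h : ℕ) (q : Fin h → O × A) (x : O × A) : ℝ :=
  (if h = 0 then ρ0 x.1 else T h q x.1) * π h q x.1 x.2

theorem trajPMF_eq_seqPMF {O A : Type} (H : ℕ) (ρ0 : O → ℝ) (T : TransModel O A)
    (π : Policy O A) : trajPMF H ρ0 T π = seqPMF (stepPMF ρ0 T π) H := rfl

theorem isPMF_stepPMF {O A : Type} [Fintype O] [Fintype A] {ρ0 : O → ℝ} (hρ0 : IsPMF ρ0)
    {T : TransModel O A} {π : Policy O A} {h : ℕ} {q : Fin h → O × A} (hT : IsPMF (T h q))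
    (hπ : ∀ o, IsPMF (π h q o)) : IsPMF (stepPMF ρ0 T π h q) := by
  unfold stepPMF
  split_ifs
  · refine ⟨fun x => mul_nonneg (hρ0.1 _) ((hπ _).1 _), ?_⟩
    simp_rw [Fintype.sum_prod_type, ← Finset.mul_sum, (hπ _).2, mul_one]
    exact hρ0.2
  · refine ⟨fun x => mul_nonneg (hT.1 _) ((hπ _).1 _), ?_⟩
    simp_rw [Fintype.sum_prod_type, ← Finset.mul_sum, (hπ _).2, mul_one]
    exact hT.2

theorem isPMF_trajPMF {O A : Type} [Fintype O] [Fintype A] {H : ℕ} {ρ0 : O → ℝ}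
    (hρ0 : IsPMF ρ0) {T : TransModel O A} {π : Policy O A}
    (hT : ∀ h, h < H → ∀ q : Fin h → O × A, IsPMF (T h q))
    (hπ : ∀ h, h < H → ∀ (q : Fin h → O × A) (o : O), IsPMF (π h q o)) :
    IsPMF (trajPMF H ρ0 T π) :=
  isPMF_seqPMF _ H fun h hh q => isPMF_stepPMF hρ0 (hT h hh q) (hπ h hh q)

theorem tvDist_nonneg {Y : Type} [Fintype Y] (p q : Y → ℝ) : 0 ≤ tvDist p q :=
  mul_nonneg (by norm_num) (Finset.sum_nonneg fun _ _ => abs_nonneg _)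

theorem sum_abs_stepPMF_sub_le {O A : Type} [Fintype O] [Fintype A] (ρ0 : O → ℝ)
    (T T' : TransModel O A) {π : Policy O A} {h : ℕ} {q : Fin h → O × A}
    (hπ : ∀ o, IsPMF (π h q o)) :
    ∑ x, |stepPMF ρ0 T' π h q x - stepPMF ρ0 T π h q x| ≤ 2 * tvDist (T h q) (T' h q) := by
  unfold stepPMF
  split_ifs
  · simpa using tvDist_nonneg (T h q) (T' h q)
  · simp_rw [← sub_mul, abs_mul, Fintype.sum_prod_type, abs_of_nonneg ((hπ _).1 _),
      ← Finset.mul_sum, (hπ _).2, mul_one, abs_sub_comm (T' h q _)]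
    unfold tvDist
    linarith

theorem sum_abs_trajPMF_sub_le {O A : Type} [Fintype O] [Fintype A] {H : ℕ} (hH : 1 ≤ H)
    {ρ0 : O → ℝ} (hρ0 : IsPMF ρ0) {T T' : TransModel O A} {π : Policy O A}
    (hT : ∀ h, h < H → ∀ q : Fin h → O × A, IsPMF (T h q))
    (hT' : ∀ h, h < H → ∀ q : Fin h → O × A, IsPMF (T' h q))
    (hπ : ∀ h, h < H → ∀ (q : Fin h → O × A) (o : O), IsPMF (π h q o)) :
    ∑ τ, |trajPMF H ρ0 T' π τ - trajPMF H ρ0 T π τ| ≤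
      2 * H * ∑ τ, trajPMF H ρ0 T π τ * modelErr H T T' τ := by
  have hH0 : (H : ℝ) ≠ 0 := by positivity
  rw [trajPMF_eq_seqPMF, trajPMF_eq_seqPMF, Finset.mul_sum]
  refine (sum_abs_seqPMF_sub_le _ _ H
    (fun h hh q => isPMF_stepPMF hρ0 (hT h hh q) (hπ h hh q))
    (fun h hh q => isPMF_stepPMF hρ0 (hT' h hh q) (hπ h hh q))).trans ?_
  refine Finset.sum_le_sum fun τ _ => ?_
  refine (mul_le_mul_of_nonneg_left (Finset.sum_le_sum fun h _ =>
    sum_abs_stepPMF_sub_le ρ0 T T' (hπ h.val h.isLt _))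
    ((isPMF_trajPMF hρ0 hT hπ).1 τ)).trans_eq ?_
  rw [← Finset.mul_sum, modelErr]
  unfold prefTraj trajPMF stepPMF seqPMF prefTraj
  field_simp

theorem abs_value_sub_le {O A : Type} [Fintype O] [Fintype A] (H : ℕ) (ρ0 : O → ℝ)
    (T T' : TransModel O A) (π : Policy O A) {r : O → A → ℝ} {R : ℝ}
    (hr : ∀ o a, |r o a| ≤ R) :
    |value H ρ0 T' π r - value H ρ0 T π r| ≤
      H * R * ∑ τ, |trajPMF H ρ0 T' π τ - trajPMF H ρ0 T π τ| := by
  unfold value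
  rw [← Finset.sum_sub_distrib, Finset.mul_sum]
  refine (Finset.abs_sum_le_sum_abs _ _).trans (Finset.sum_le_sum fun τ _ => ?_)
  rw [← sub_mul, abs_mul, mul_comm]
  refine mul_le_mul_of_nonneg_right ?_ (abs_nonneg _)
  refine (Finset.abs_sum_le_sum_abs _ _).trans ?_
  refine (Finset.sum_le_sum fun t _ => hr _ _).trans_eq ?_
  simp

/-- A Pinsker-type inequality, with a constant weaker than the optimal one. -/
theorem sq_tvDist_le_klDiv {Y : Type} [Fintype Y] {p q : Y → ℝ} (hp : IsPMF p) (hq : IsPMF q)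
    (hpq : ∀ y, q y = 0 → p y = 0) : tvDist p q ^ 2 ≤ klDiv p q := by
  have hS : ∑ y, (√(p y) - √(q y)) ^ 2 ≤ klDiv p q := by
    have hy : ∀ y, (√(p y) - √(q y)) ^ 2 + (p y - q y) ≤ p y * Real.log (p y / q y) := by
      intro y
      have hsp := Real.sq_sqrt (hp.1 y)
      have hsq := Real.sq_sqrt (hq.1 y)
      rcases (hp.1 y).eq_or_lt with h0 | h0
      · rw [← h0]
        simp [hsq]
      · have hq0 : 0 < q y := (hq.1 y).lt_of_ne' fun h => h0.ne' (hpq y h)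
        have ha := Real.sqrt_pos.2 h0
        have hb := Real.sqrt_pos.2 hq0
        have hlog := Real.log_le_sub_one_of_pos (div_pos hb ha)
        have heq : Real.log (p y / q y) = -(2 * Real.log (√(q y) / √(p y))) := by
          rw [Real.log_div h0.ne' hq0.ne', Real.log_div hb.ne' ha.ne',
            Real.log_sqrt h0.le, Real.log_sqrt hq0.le]
          ring
        have hmul : p y * (√(q y) / √(p y)) = √(p y) * √(q y) := by
          rw [← mul_div_assoc, div_eq_iff ha.ne']
          linear_combination -√(q y) * hsp
        rw [heq]
        have := mul_le_mul_of_nonneg_left hlog h0.le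
        nlinarith
    have := Finset.sum_le_sum fun y (_ : y ∈ Finset.univ) => hy y
    rw [Finset.sum_add_distrib, Finset.sum_sub_distrib, hp.2, hq.2] at this
    unfold klDiv
    linarith
  have hR : ∑ y, (√(p y) + √(q y)) ^ 2 ≤ 4 := by
    have hy : ∀ y, (√(p y) + √(q y)) ^ 2 ≤ 2 * p y + 2 * q y := by
      intro y
      have hsp := Real.sq_sqrt (hp.1 y)
      have hsq := Real.sq_sqrt (hq.1 y)
      nlinarith [sq_nonneg (√(p y) - √(q y))]
    refine (Finset.sum_le_sum fun y _ => hy y).trans_eq ?_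
    rw [Finset.sum_add_distrib, ← Finset.mul_sum, ← Finset.mul_sum, hp.2, hq.2]
    norm_num
  have habs : ∑ y, |p y - q y| = ∑ y, |√(p y) - √(q y)| * (√(p y) + √(q y)) := by
    refine Finset.sum_congr rfl fun y _ => ?_
    have hnn := add_nonneg (Real.sqrt_nonneg (p y)) (Real.sqrt_nonneg (q y))
    nth_rewrite 1 [← abs_of_nonneg hnn]
    rw [← abs_mul]
    congr 1
    linear_combination Real.sq_sqrt (hq.1 y) - Real.sq_sqrt (hp.1 y)
  have hCS := Finset.sum_mul_sq_le_sq_mul_sq Finset.univ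
    (fun y => |√(p y) - √(q y)|) (fun y => √(p y) + √(q y))
  simp_rw [sq_abs] at hCS
  have hS0 : 0 ≤ ∑ y, (√(p y) - √(q y)) ^ 2 := Finset.sum_nonneg fun _ _ => sq_nonneg _
  unfold tvDist
  rw [habs, mul_pow]
  nlinarith [mul_le_mul_of_nonneg_left hR hS0]

theorem IsPMF.sq_sum_mul_le {Y : Type} [Fintype Y] {p : Y → ℝ} (hp : IsPMF p) (f : Y → ℝ) :
    (∑ y, p y * f y) ^ 2 ≤ ∑ y, p y * f y ^ 2 := by
  have h0 : 0 ≤ ∑ y, p y * (f y - ∑ z, p z * f z) ^ 2 :=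
    Finset.sum_nonneg fun y _ => mul_nonneg (hp.1 y) (sq_nonneg _)
  generalize hm : ∑ z, p z * f z = m at h0 ⊢
  have heq : ∑ y, p y * (f y - m) ^ 2 =
      ∑ y, p y * f y ^ 2 - 2 * m * ∑ y, p y * f y + m ^ 2 * ∑ y, p y := by
    rw [Finset.mul_sum _ _ (2 * m), Finset.mul_sum _ _ (m ^ 2), ← Finset.sum_sub_distrib, ← Finset.sum_add_distrib]
    exact Finset.sum_congr rfl fun y _ => by ring
  rw [heq, hp.2, hm] at h0
  nlinarith

theorem sq_modelErr_le_trajKL {O A : Type} [Fintype O] {H : ℕ} (hH : 1 ≤ H)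
    {T T' : TransModel O A}
    (hT : ∀ h, h < H → ∀ q : Fin h → O × A, IsPMF (T h q))
    (hT' : ∀ h, h < H → ∀ q : Fin h → O × A, IsPMF (T' h q))
    (habs : ∀ h, h < H → ∀ (q : Fin h → O × A) (o : O), T' h q o = 0 → T h q o = 0)
    (τ : Fin H → O × A) : modelErr H T T' τ ^ 2 ≤ trajKL H T T' τ := by
  have hH0 : (H : ℝ) ≠ 0 := by positivity
  have hunif : IsPMF (fun _ : Fin H => (1 / H : ℝ)) :=
    ⟨fun _ => by positivity, by simp [hH0]⟩
  unfold modelErr trajKL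
  rw [Finset.mul_sum, Finset.mul_sum]
  refine (hunif.sq_sum_mul_le _).trans (Finset.sum_le_sum fun h _ => ?_)
  exact mul_le_mul_of_nonneg_left (sq_tvDist_le_klDiv (hT h.val h.isLt _) (hT' h.val h.isLt _)
    (habs h.val h.isLt _)) (by positivity)

theorem IsPMF.mixture {I S : Type} [Fintype I] [Fintype S] {w : I → ℝ} (hw : IsPMF w)
    {p : I → S → ℝ} (hp : ∀ i, IsPMF (p i)) : IsPMF (fun s => ∑ i, w i * p i s) := by
  refine ⟨fun s => Finset.sum_nonneg fun i _ => mul_nonneg (hw.1 i) ((hp i).1 s), ?_⟩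
  rw [Finset.sum_comm]
  simp_rw [← Finset.mul_sum, (hp _).2, mul_one]
  exact hw.2

/-- The easy direction of Kantorovich duality. -/
theorem sum_mul_sub_le_mul_W1 {S : Type} [Fintype S] {D : S → S → ℝ} {p q : S → ℝ}
    (hp : IsPMF p) (hq : IsPMF q) {f : S → ℝ} {L : ℝ} (hL : 0 ≤ L)
    (hf : ∀ s s', f s - f s' ≤ L * D s s') :
    ∑ s, p s * f s - ∑ s, q s * f s ≤ L * W1 D p q := by
  have hcoup : ∀ c ∈ {c : ℝ | ∃ γ : S × S → ℝ, IsPMF γ ∧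
      (∀ τ, ∑ τ', γ (τ, τ') = p τ) ∧ (∀ τ', ∑ τ, γ (τ, τ') = q τ') ∧
      c = ∑ pr : S × S, γ pr * D pr.1 pr.2},
      ∑ s, p s * f s - ∑ s, q s * f s ≤ L * c := by
    rintro c ⟨γ, hγ, h1, h2, rfl⟩
    have e1 : ∑ s, p s * f s = ∑ x : S × S, γ x * f x.1 := by
      simp_rw [Fintype.sum_prod_type, ← h1, Finset.sum_mul]
    have e2 : ∑ s, q s * f s = ∑ x : S × S, γ x * f x.2 := by
      simp_rw [Fintype.sum_prod_type_right, ← h2, Finset.sum_mul]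
    rw [e1, e2, ← Finset.sum_sub_distrib, Finset.mul_sum]
    refine Finset.sum_le_sum fun x _ => ?_
    have := mul_le_mul_of_nonneg_left (hf x.1 x.2) (hγ.1 x)
    linarith
  have hprod : IsPMF (fun x : S × S => p x.1 * q x.2) := by
    refine ⟨fun x => mul_nonneg (hp.1 _) (hq.1 _), ?_⟩
    simp_rw [Fintype.sum_prod_type, ← Finset.mul_sum, hq.2, mul_one]
    exact hp.2
  have hne : {c : ℝ | ∃ γ : S × S → ℝ, IsPMF γ ∧
      (∀ τ, ∑ τ', γ (τ, τ') = p τ) ∧ (∀ τ', ∑ τ, γ (τ, τ') = q τ') ∧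
      c = ∑ pr : S × S, γ pr * D pr.1 pr.2}.Nonempty :=
    ⟨_, _, hprod, fun s => by simp [← Finset.mul_sum, hq.2],
      fun s => by simp [← Finset.sum_mul, hp.2], rfl⟩
  rcases hL.eq_or_lt with rfl | hL
  · obtain ⟨c, hc⟩ := hne
    simpa using hcoup c hc
  · rw [← div_le_iff₀' hL]
    exact le_csInf hne fun c hc => (div_le_iff₀' hL).2 (hcoup c hc)

/-- Proposition 1 (value gap of a common world model):
`|V^π_T − V^π_{T*}| ≤ 2 R_max H² (√(2 l_KL(T;Π)) + L · W₁(d^π, d^Π))`. -/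
theorem value_gap_common_model {O A : Type} [Fintype O] [Fintype A]
    [Nonempty O] [Nonempty A]
    (H : ℕ) (hH : 1 ≤ H)
    (ρ0 : O → ℝ) (hρ0 : IsPMF ρ0)
    (r : O → A → ℝ) (Rmax : ℝ) (hr : ∀ o a, |r o a| ≤ Rmax)
    (Tstar T : TransModel O A)
    (hTstar : ∀ h, h < H → ∀ hist : Fin h → O × A, IsPMF (Tstar h hist))
    (hT : ∀ h, h < H → ∀ hist : Fin h → O × A, IsPMF (T h hist))
    (habs : ∀ h, h < H → ∀ (hist : Fin h → O × A) (o : O),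
      T h hist o = 0 → Tstar h hist o = 0)
    -- a distribution `Π` over finitely many behavior policies `μ i` with weights `w i`
    {I : Type} [Fintype I] [Nonempty I]
    (μ : I → Policy O A)
    (hμ : ∀ i h, h < H → ∀ (hist : Fin h → O × A) (o : O), IsPMF (μ i h hist o))
    (w : I → ℝ) (hw : IsPMF w)
    -- the target policy
    (π : Policy O A)
    (hπ : ∀ h, h < H → ∀ (hist : Fin h → O × A) (o : O), IsPMF (π h hist o))
    -- a metric `D` on the trajectory space
    (D : (Fin H → O × A) → (Fin H → O × A) → ℝ)
    (hD_eq : ∀ τ τ', D τ τ' = 0 ↔ τ = τ')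
    (hD_symm : ∀ τ τ', D τ τ' = D τ' τ)
    (hD_tri : ∀ τ τ' τ'', D τ τ'' ≤ D τ τ' + D τ' τ'')
    -- `e_T` is `L`-Lipschitz with respect to `D`
    (L : ℝ) (hL : 0 ≤ L)
    (hLip : ∀ τ τ' : Fin H → O × A,
      |modelErr H Tstar T τ - modelErr H Tstar T τ'| ≤ L * D τ τ') :
    |value H ρ0 T π r - value H ρ0 Tstar π r| ≤
      2 * Rmax * (H : ℝ) ^ 2 *
        (Real.sqrt (2 * ∑ i, w i *
            ∑ τ : Fin H → O × A, trajPMF H ρ0 Tstar (μ i) τ * trajKL H Tstar T τ) +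
          L * W1 D (trajPMF H ρ0 Tstar π)
            (fun τ => ∑ i, w i * trajPMF H ρ0 Tstar (μ i) τ)) := by
  have hq := isPMF_trajPMF hρ0 hTstar hπ
  have hmix := hw.mixture fun i => isPMF_trajPMF hρ0 hTstar (hμ i)
  have hR : 0 ≤ Rmax := (abs_nonneg _).trans (hr (Classical.arbitrary O) (Classical.arbitrary A))
  have hgap := abs_value_sub_le H ρ0 Tstar T π hr
  have hl1 := mul_le_mul_of_nonneg_left (sum_abs_trajPMF_sub_le hH hρ0 hTstar hT hπ)
    (mul_nonneg H.cast_nonneg hR)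
  have hW := sum_mul_sub_le_mul_W1 (D := D) hq hmix hL
    fun τ τ' => (le_abs_self _).trans (hLip τ τ')
  have hloss : ∑ i, w i * ∑ τ : Fin H → O × A, trajPMF H ρ0 Tstar (μ i) τ * trajKL H Tstar T τ =
      ∑ τ, (∑ i, w i * trajPMF H ρ0 Tstar (μ i) τ) * trajKL H Tstar T τ := by
    simp_rw [Finset.sum_mul, Finset.mul_sum, mul_assoc]
    exact Finset.sum_comm
  have hsq : (∑ τ, (∑ i, w i * trajPMF H ρ0 Tstar (μ i) τ) * modelErr H Tstar T τ) ^ 2 ≤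
      ∑ τ, (∑ i, w i * trajPMF H ρ0 Tstar (μ i) τ) * trajKL H Tstar T τ :=
    (hmix.sq_sum_mul_le _).trans (Finset.sum_le_sum fun τ _ =>
      mul_le_mul_of_nonneg_left (sq_modelErr_le_trajKL hH hTstar hT habs τ) (hmix.1 τ))
  have hsqrt : ∑ τ, (∑ i, w i * trajPMF H ρ0 Tstar (μ i) τ) * modelErr H Tstar T τ ≤
      √(2 * ∑ τ, (∑ i, w i * trajPMF H ρ0 Tstar (μ i) τ) * trajKL H Tstar T τ) :=
    Real.le_sqrt_of_sq_le (by linarith [(sq_nonneg _).trans hsq])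
  rw [hloss]
  calc _ ≤ 2 * Rmax * (H : ℝ) ^ 2 * ∑ τ, trajPMF H ρ0 Tstar π τ * modelErr H Tstar T τ :=
        (hgap.trans hl1).trans_eq (by ring)
    _ ≤ _ := mul_le_mul_of_nonneg_left (by linarith) (by positivity)
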